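/- arXiv:2410.03047 — 2 statements merged into one kernel-verified Lean document; each statement's English description precedes it below -/
import Mathlib

section
/- Let d ≥ 2 and let a₀ : Set.Icc (0:ℝ) 1 → (Fin (d−1) → ℂ) be continuous such that the shape of cvl(p_{a₀ t}) is weakly decreasing in time: for all s ≤ t in Set.Icc (0:ℝ) 1, the shape of cvl(p_{a₀ s}) is a merge of the shape of cvl(p_{a₀ t}). Fix x₀ : Fin (d−1) → ℂ with cvl(p_{x₀}) = cvl(p_{a₀ 0}). Then the set of continuous maps a : Set.Icc (0:ℝ) 1 → (Fin (d−1) → ℂ) with a 0 = x₀ and cvl(p_{a t}) = cvl(p_{a₀ t}) for all t is finite and has at most d^{d−2} elements. -/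
open Polynomial

/-- The monic centered polynomial `X^d + ∑_{i=0}^{d-2} (a i)·X^i` determined by the
coefficient vector `a`. -/
noncomputable def mcPoly (d : ℕ) (a : Fin (d - 1) → ℂ) : ℂ[X] :=
  X ^ d + ∑ i : Fin (d - 1), C (a i) * X ^ (i : ℕ)

/-- The critical value multiset of a polynomial: the multiset of values of `p` at the
roots (with multiplicity) of its derivative. -/
noncomputable def cvl (p : ℂ[X]) : Multiset ℂ :=
  Multiset.map (fun z => p.eval z) p.derivative.roots

/-- The shape of a finite multiset: the multiset of multiplicities of its distinct
elements. -/
noncomputable def mshape {X : Type*} (M : Multiset X) : Multiset ℕ :=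
  letI := Classical.decEq X
  Multiset.map (fun a => M.count a) M.toFinset.val

/-- `IsMergeOf μ lam` means `μ` is obtained from `lam` by grouping its entries and
replacing each (nonempty) group by its sum. -/
def IsMergeOf (μ lam : Multiset ℕ) : Prop :=
  ∃ m : Multiset (Multiset ℕ), (∀ s ∈ m, s ≠ 0) ∧ m.join = lam ∧
    Multiset.map Multiset.sum m = μ

/-- The monomial exponents in `n` variables of total degree at most `m`. -/
noncomputable def expLE (n m : ℕ) : Finset (Fin n →₀ ℕ) :=
  (Finset.range (m + 1)).biUnion fun j => Finset.finsuppAntidiag Finset.univ j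

theorem mem_expLE {n m : ℕ} {e : Fin n →₀ ℕ} : e ∈ expLE n m ↔ ∑ i, e i ≤ m := by
  simp [expLE]

theorem card_expLE (n m : ℕ) : (expLE n m).card = (m + n).choose n := by
  rw [expLE, Finset.card_biUnion]
  · simp_rw [Finset.card_finsuppAntidiag_nat_eq_multichoose, Finset.card_univ, Fintype.card_fin]
    exact Nat.sum_range_multichoose m n
  · intro i _ j _ hij
    rw [Function.onFun, Finset.disjoint_left]
    intro e he he'
    simp only [Finset.mem_finsuppAntidiag] at he he'
    exact hij (he.1.symm.trans he'.1)

theorem finrank_restrictTotalDegree (n m : ℕ) :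
    Module.finrank ℂ (MvPolynomial.restrictTotalDegree (Fin n) ℂ m) = (m + n).choose n := by
  rw [MvPolynomial.restrictTotalDegree,
    Module.finrank_eq_nat_card_basis (MvPolynomial.basisRestrictSupport ℂ _), ← card_expLE,
    ← Nat.card_eq_finsetCard]
  refine Nat.card_congr (Equiv.subtypeEquivRight fun e => ?_)
  rw [mem_expLE, Set.mem_ofPred_eq, Finsupp.sum_fintype _ _ fun _ => rfl]

/-- A comparison of the growth of two binomial coefficients. -/
theorem le_pow_of_forall_mul_choose_le {n d k c : ℕ}
    (h : ∀ m : ℕ, k * (m + n).choose n ≤ (d * m + c + n).choose n) : k ≤ d ^ n := by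
  have h1 : ∀ m : ℕ, 1 ≤ m → (k : ℝ) ≤ (d + (c + n : ℕ) / (m : ℝ)) ^ n := by
    intro m hm
    have h2 : k * m ^ n ≤ (d * m + c + n) ^ n := by
      calc k * m ^ n ≤ k * (m + 1).ascFactorial n := by
            gcongr
            exact (Nat.pow_le_pow_left (Nat.le_succ m) n).trans (Nat.pow_succ_le_ascFactorial _ _)
        _ = n.factorial * (k * (m + n).choose n) := by
            rw [Nat.ascFactorial_eq_factorial_mul_choose]; ring
        _ ≤ n.factorial * (d * m + c + n).choose n := by gcongr; exact h m
        _ = (d * m + c + 1).ascFactorial n := by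
            rw [Nat.ascFactorial_eq_factorial_mul_choose]
        _ ≤ _ := Nat.ascFactorial_le_pow_add _ _
    have hm0 : (0 : ℝ) < m := by exact_mod_cast hm
    have h3 : (k : ℝ) * (m : ℝ) ^ n ≤ ((d : ℝ) * m + c + n) ^ n := by exact_mod_cast h2
    have h4 : (d + (c + n : ℕ) / (m : ℝ)) = ((d : ℝ) * m + c + n) / m := by
      push_cast; field_simp; ring
    rw [h4, div_pow, le_div_iff₀ (by positivity)]
    exact h3
  have h5 : Filter.Tendsto (fun m : ℕ => ((d : ℝ) + (c + n : ℕ) / (m : ℝ)) ^ n) Filter.atTop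
      (nhds (((d : ℝ) + 0) ^ n)) :=
    ((tendsto_const_div_atTop_nhds_zero_nat _).const_add _).pow n
  have h6 := ge_of_tendsto h5 (Filter.eventually_atTop.2 ⟨1, h1⟩)
  rw [add_zero] at h6
  exact_mod_cast h6

open MvPolynomial in
/-- A homogeneous element of an ideal generated by homogeneous elements has homogeneous
coefficients. -/
theorem exists_homogeneous_coeffs {n d N : ℕ} {F : Fin n → MvPolynomial (Fin n) ℂ}
    (hF : ∀ i, (F i).IsHomogeneous d) {p : MvPolynomial (Fin n) ℂ} (hp : p.IsHomogeneous N)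
    (hd : d ≤ N) (hmem : p ∈ Ideal.span (Set.range F)) :
    ∃ G : Fin n → MvPolynomial (Fin n) ℂ, (∀ i, (G i).IsHomogeneous (N - d)) ∧
      p = ∑ i, G i * F i := by
  let : GradedAlgebra (homogeneousSubmodule (Fin n) ℂ) := gradedAlgebra
  obtain ⟨G, hG⟩ := Ideal.mem_span_range_iff_exists_fun.1 hmem
  refine ⟨fun i => homogeneousComponent (N - d) (G i),
    fun i => homogeneousComponent_isHomogeneous _ _, ?_⟩
  have key : ∀ i, homogeneousComponent N (G i * F i) =
      homogeneousComponent (N - d) (G i) * F i := by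
    intro i
    have h := DirectSum.coe_decompose_mul_of_right_mem_of_le (homogeneousSubmodule (Fin n) ℂ)
      (a := G i) (b := F i) ((mem_homogeneousSubmodule _ _).2 (hF i)) hd
    have e : ∀ (φ : MvPolynomial (Fin n) ℂ) (k : ℕ),
        (DirectSum.decompose (homogeneousSubmodule (Fin n) ℂ) φ k : MvPolynomial (Fin n) ℂ) =
          homogeneousComponent k φ := fun φ k => decomposition.decompose'_apply φ k
    rwa [e, e] at h
  calc p = homogeneousComponent N p := by
        rw [homogeneousComponent_of_mem ((mem_homogeneousSubmodule _ _).2 hp), if_pos rfl]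
    _ = _ := by rw [← hG, map_sum]; exact Finset.sum_congr rfl fun i _ => key i

open MvPolynomial in
theorem exists_X_pow_mem_span {n : ℕ} {F : Fin n → MvPolynomial (Fin n) ℂ}
    (hzero : ∀ x : Fin n → ℂ, (∀ i, eval x (F i) = 0) → x = 0) :
    ∃ N : ℕ, ∀ M, N ≤ M → ∀ i, (X i : MvPolynomial (Fin n) ℂ) ^ M ∈ Ideal.span (Set.range F) := by
  have h1 : ∀ i, (X i : MvPolynomial (Fin n) ℂ) ∈ (Ideal.span (Set.range F)).radical := by
    intro i
    rw [← vanishingIdeal_zeroLocus_eq_radical (K := ℂ), mem_vanishingIdeal_iff]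
    intro x hx
    have : x = 0 := hzero x fun j => by
      simpa [aeval_eq_eval] using hx (F j) (Ideal.subset_span ⟨j, rfl⟩)
    simp [this]
  choose N hN using h1
  exact ⟨∑ i, N i, fun M hM i => Ideal.pow_mem_of_pow_mem _ (hN i)
    ((Finset.single_le_sum (fun _ _ => Nat.zero_le _) (Finset.mem_univ i)).trans hM)⟩

open MvPolynomial in
/-- Homogeneous polynomials of positive degree without a common nontrivial zero generate a
subalgebra over which the polynomial ring is integral. -/
theorem isIntegral_adjoin_of_homogeneous {n d : ℕ} (hd : 0 < d)
    {F : Fin n → MvPolynomial (Fin n) ℂ} (hF : ∀ i, (F i).IsHomogeneous d)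
    (hzero : ∀ x : Fin n → ℂ, (∀ i, eval x (F i) = 0) → x = 0) :
    Algebra.IsIntegral (Algebra.adjoin ℂ (Set.range F)) (MvPolynomial (Fin n) ℂ) := by
  obtain ⟨N₀, hN₀⟩ := exists_X_pow_mem_span hzero
  obtain ⟨N, hdN, hN⟩ : ∃ N, d ≤ N ∧ N₀ ≤ N := ⟨max d N₀, le_max_left _ _, le_max_right _ _⟩
  choose G hGhom hG using fun i => exists_homogeneous_coeffs hF
    (isHomogeneous_X_pow (R := ℂ) i N) hdN (hN₀ N hN i)
  set B := Algebra.adjoin ℂ (Set.range F)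
  set T : Finset (MvPolynomial (Fin n) ℂ) :=
    (expLE n (n * N)).image fun e => monomial e (1 : ℂ) with hT
  set M : Submodule B (MvPolynomial (Fin n) ℂ) := Submodule.span B T with hM
  have hC : ∀ (c : ℂ) {p : MvPolynomial (Fin n) ℂ}, p ∈ M → MvPolynomial.C c * p ∈ M := by
    intro c p hp
    have := M.smul_mem (algebraMap ℂ B c) hp
    rwa [algebraMap_smul, MvPolynomial.smul_eq_C_mul] at this
  have hsum : ∀ {p : MvPolynomial (Fin n) ℂ},
      (∀ e ∈ p.support, monomial e (1 : ℂ) ∈ M) → p ∈ M := by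
    intro p hp
    rw [p.as_sum]
    refine M.sum_mem fun e he => ?_
    have := hC (coeff e p) (hp e he)
    rwa [MvPolynomial.C_mul_monomial, mul_one] at this
  have hmon : ∀ D : ℕ, ∀ e : Fin n →₀ ℕ, ∑ i, e i = D → monomial e (1 : ℂ) ∈ M := by
    intro D
    induction D using Nat.strong_induction_on with
    | _ D ih =>
    intro e he
    by_cases hsmall : ∑ i, e i ≤ n * N
    · refine Submodule.subset_span ?_
      rw [hT, Finset.coe_image]
      exact ⟨e, mem_expLE.2 hsmall, rfl⟩
    obtain ⟨i, hi⟩ : ∃ i, N ≤ e i := by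
      by_contra! hcon
      apply hsmall
      calc ∑ i, e i ≤ ∑ _i : Fin n, N := Finset.sum_le_sum fun i _ => (hcon i).le
        _ = n * N := by simp
    have hle : Finsupp.single i N ≤ e := by simpa using hi
    have hdec : monomial e (1 : ℂ) = ∑ j, F j * (G i j * monomial (e - Finsupp.single i N) 1) := by
      calc monomial e (1 : ℂ) = X i ^ N * monomial (e - Finsupp.single i N) 1 := by
            rw [MvPolynomial.X_pow_eq_monomial, monomial_mul, one_mul, add_tsub_cancel_of_le hle]
        _ = _ := by
            rw [hG i, Finset.sum_mul]
            exact Finset.sum_congr rfl fun j _ => by ring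
    have hdeg : ∑ j, (e - Finsupp.single i N) j = D - N := by
      have h1 : ∑ j, (e - Finsupp.single i N) j + ∑ j, (Finsupp.single i N) j = ∑ j, e j := by
        rw [← Finset.sum_add_distrib]
        exact Finset.sum_congr rfl fun j _ => by
          rw [← Finsupp.add_apply, tsub_add_cancel_of_le hle]
      rw [he, Finsupp.univ_sum_single_apply] at h1
      omega
    have hND : N ≤ D := by
      rw [← he]
      exact hi.trans (Finset.single_le_sum (fun _ _ => Nat.zero_le _) (Finset.mem_univ i))
    rw [hdec]
    refine M.sum_mem fun j _ => ?_
    have hFB : F j ∈ B := Algebra.subset_adjoin ⟨j, rfl⟩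
    refine M.smul_mem (⟨F j, hFB⟩ : B) (hsum fun e' he' => ?_)
    refine ih (∑ i, e' i) ?_ e' rfl
    have hhom : (G i j * monomial (e - Finsupp.single i N) (1 : ℂ)).IsHomogeneous
        (N - d + (D - N)) :=
      (hGhom i j).mul (isHomogeneous_monomial _ (by
        rw [← hdeg, Finsupp.degree_eq_sum]))
    have := hhom (mem_support_iff.1 he')
    rw [show Finsupp.weight 1 e' = e'.degree from
      (DFunLike.congr_fun (Finsupp.degree_eq_weight_one (R := ℕ)) e').symm, Finsupp.degree_eq_sum] at this
    omega
  have htop : M = ⊤ := by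
    rw [eq_top_iff]
    intro p _
    exact hsum fun e _ => hmon _ e rfl
  have : Module.Finite B (MvPolynomial (Fin n) ℂ) := ⟨⟨T, htop⟩⟩
  exact Algebra.IsIntegral.of_finite B _

open MvPolynomial in
theorem algebraicIndependent_of_isIntegral {n : ℕ} {F : Fin n → MvPolynomial (Fin n) ℂ}
    (h : Algebra.IsIntegral (Algebra.adjoin ℂ (Set.range F)) (MvPolynomial (Fin n) ℂ)) :
    AlgebraicIndependent ℂ F := by
  have : Algebra.IsAlgebraic (Algebra.adjoin ℂ (Set.range F)) (MvPolynomial (Fin n) ℂ) :=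
    inferInstance
  refine (Algebra.IsAlgebraic.isTranscendenceBasis_of_lift_le_trdeg_of_finite ℂ F ?_).1
  rw [MvPolynomial.trdeg_of_isDomain]
  simp

/-- Integral elements over integrally closed domains are roots of a monic polynomial of the least
possible degree. -/
theorem exists_monic_minimal {R S : Type*} [CommRing R] [IsDomain R] [IsIntegrallyClosed R]
    [CommRing S] [IsDomain S] (f : R →+* S) (hf : Function.Injective f) {h : S}
    (hh : f.IsIntegralElem h) :
    ∃ p : R[X], p.Monic ∧ p.eval₂ f h = 0 ∧
      ∀ q : R[X], q ≠ 0 → q.eval₂ f h = 0 → p.natDegree ≤ q.natDegree := by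
  algebraize [f]
  have : FaithfulSMul R S := (faithfulSMul_iff_algebraMap_injective R S).2 hf
  have : Module.IsTorsionFree R S := inferInstance
  have hint : IsIntegral R h := hh
  refine ⟨minpoly R h, minpoly.monic hint, minpoly.aeval R h, fun q hq hq0 => ?_⟩
  exact natDegree_le_natDegree (minpoly.IsIntegrallyClosed.degree_le_of_ne_zero hq hq0)

open MvPolynomial in
theorem totalDegree_aeval_le {n d : ℕ} {F : Fin n → MvPolynomial (Fin n) ℂ}
    (hF : ∀ i, (F i).totalDegree ≤ d) {m : ℕ} {p : MvPolynomial (Fin n) ℂ}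
    (hp : p.totalDegree ≤ m) : (aeval F p).totalDegree ≤ d * m := by
  rw [MvPolynomial.aeval_def, eval₂_eq']
  refine totalDegree_finsetSum_le fun e he => ?_
  rw [algebraMap_eq]
  refine (totalDegree_mul _ _).trans ?_
  rw [totalDegree_C, zero_add]
  refine (totalDegree_finsetProd _ _).trans ?_
  have h1 : ∑ i, e i ≤ m := by
    refine le_trans ?_ ((le_totalDegree he).trans hp)
    rw [Finsupp.sum_fintype _ _ fun _ => rfl]
  calc ∑ i, (F i ^ e i).totalDegree ≤ ∑ i, e i * d :=
        Finset.sum_le_sum fun i _ => (totalDegree_pow _ _).trans (Nat.mul_le_mul_left _ (hF i))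
    _ = d * ∑ i, e i := by rw [← Finset.sum_mul, mul_comm]
    _ ≤ d * m := Nat.mul_le_mul_left _ h1

open MvPolynomial in
theorem exists_separating_linear_form {n : ℕ} (s : Finset (Fin n → ℂ)) :
    ∃ h : MvPolynomial (Fin n) ℂ, h.totalDegree ≤ 1 ∧
      Set.InjOn (fun x => eval x h) (s : Set (Fin n → ℂ)) := by
  obtain ⟨φ, hφ⟩ := Module.exists_dual_forall_apply_ne_zero (K := ℂ)
    (fun q : {q : s × s // q.1 ≠ q.2} => (q.1.1 : Fin n → ℂ) - q.1.2)
    (fun q => sub_ne_zero.2 fun hq => q.2 (Subtype.ext hq))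
  have heval : ∀ x, eval x (∑ i, MvPolynomial.C (φ (Pi.single i 1)) * X i) = φ x := by
    intro x
    conv_rhs => rw [LinearMap.pi_apply_eq_sum_univ φ x]
    simp only [map_sum, map_mul, MvPolynomial.eval_C, MvPolynomial.eval_X, smul_eq_mul]
    refine Finset.sum_congr rfl fun i _ => ?_
    rw [mul_comm]
    congr 2
    funext j
    simp [Pi.single_apply, eq_comm]
  refine ⟨∑ i, MvPolynomial.C (φ (Pi.single i 1)) * X i, ?_, ?_⟩
  · refine totalDegree_finsetSum_le fun i _ => (totalDegree_mul _ _).trans ?_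
    rw [totalDegree_C, zero_add, totalDegree_X]
  · intro x hx y hy hxy
    by_contra hne
    simp only [heval] at hxy
    refine hφ ⟨(⟨x, hx⟩, ⟨y, hy⟩), fun h => hne (Subtype.ext_iff.1 h)⟩ ?_
    rw [map_sub, sub_eq_zero]
    exact hxy

open MvPolynomial in
/-- Bézout bound: a fibre of a map given by `n` homogeneous polynomials of degree `d` in `n`
variables without a common nontrivial zero has at most `d ^ n` points. -/
theorem card_le_pow_of_homogeneous {n d : ℕ} (hd : 0 < d)
    {F : Fin n → MvPolynomial (Fin n) ℂ} (hF : ∀ i, (F i).IsHomogeneous d)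
    (hzero : ∀ x : Fin n → ℂ, (∀ i, eval x (F i) = 0) → x = 0)
    (v : Fin n → ℂ) (s : Finset (Fin n → ℂ)) (hs : ∀ x ∈ s, ∀ i, eval x (F i) = v i) :
    s.card ≤ d ^ n := by
  have hint := isIntegral_adjoin_of_homogeneous hd hF hzero
  have hind := algebraicIndependent_of_isIntegral hint
  obtain ⟨h, hdeg, hsep⟩ := exists_separating_linear_form s
  set f : MvPolynomial (Fin n) ℂ →+* MvPolynomial (Fin n) ℂ :=
    (aeval F : MvPolynomial (Fin n) ℂ →ₐ[ℂ] MvPolynomial (Fin n) ℂ).toRingHom with hf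
  have hfinj : Function.Injective f := hind
  have hh : f.IsIntegralElem h := by
    obtain ⟨p, hp, hp0⟩ := hint.isIntegral h
    refine ⟨p.map (hind.aevalEquiv.symm : _ →+* _), hp.map _, ?_⟩
    rw [Polynomial.eval₂_map]
    convert hp0
    refine RingHom.ext fun b => ?_
    obtain ⟨b, rfl⟩ := hind.aevalEquiv.surjective b
    simp [hf]
  obtain ⟨p, hp, hp0, hmin⟩ := exists_monic_minimal f hfinj hh
  have hcard : s.card ≤ p.natDegree := by
    set pv := p.map (eval v) with hpv
    have hpvm : pv.Monic := hp.map _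
    have hroot : ∀ x ∈ s, eval x h ∈ pv.roots.toFinset := by
      intro x hx
      rw [Multiset.mem_toFinset, mem_roots hpvm.ne_zero, IsRoot, Polynomial.eval_map]
      have h1 := congrArg (MvPolynomial.eval x) hp0
      rw [map_zero, Polynomial.hom_eval₂] at h1
      have hcomp : MvPolynomial.eval v = (MvPolynomial.eval x).comp f :=
        MvPolynomial.ringHom_ext (fun c => by simp [hf]) fun i => by simp [hf, hs x hx i]
      rw [hcomp]
      exact h1
    calc s.card ≤ pv.roots.toFinset.card := Finset.card_le_card_of_injOn _ hroot hsep
      _ ≤ pv.roots.card := Multiset.toFinset_card_le _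
      _ ≤ pv.natDegree := pv.card_roots'
      _ = p.natDegree := hp.natDegree_map _
  refine hcard.trans (le_pow_of_forall_mul_choose_le (c := p.natDegree) fun m => ?_)
  set k := p.natDegree with hk
  rw [← finrank_restrictTotalDegree, ← finrank_restrictTotalDegree]
  let L : (Fin k → restrictTotalDegree (Fin n) ℂ m) →ₗ[ℂ] MvPolynomial (Fin n) ℂ :=
    ∑ i : Fin k, (LinearMap.mulRight ℂ (h ^ (i : ℕ))) ∘ₗ (MvPolynomial.aeval F).toLinearMap ∘ₗ
      (restrictTotalDegree (Fin n) ℂ m).subtype ∘ₗ LinearMap.proj i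
  have hL : ∀ c, L c = ∑ i : Fin k, f (c i) * h ^ (i : ℕ) := by
    intro c
    simp [L, hf]
  have hLmem : ∀ c, L c ∈ restrictTotalDegree (Fin n) ℂ (d * m + k) := by
    intro c
    rw [hL, mem_restrictTotalDegree]
    refine totalDegree_finsetSum_le fun i _ => (totalDegree_mul _ _).trans (add_le_add ?_ ?_)
    · exact totalDegree_aeval_le (fun i => (hF i).totalDegree_le)
        ((mem_restrictTotalDegree _ _ _).1 (c i).2)
    · refine (totalDegree_pow _ _).trans ?_
      calc (i : ℕ) * h.totalDegree ≤ i * 1 := Nat.mul_le_mul_left _ hdeg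
        _ ≤ k := by have := i.2; omega
  have hLinj : Function.Injective (L.codRestrict _ hLmem) := by
    rw [← LinearMap.ker_eq_bot, LinearMap.ker_codRestrict, LinearMap.ker_eq_bot']
    intro c hc
    rw [hL] at hc
    set q : (MvPolynomial (Fin n) ℂ)[X] :=
      ∑ i : Fin k, Polynomial.C (c i : MvPolynomial (Fin n) ℂ) * Polynomial.X ^ (i : ℕ) with hq
    have hq0 : q.eval₂ f h = 0 := by
      rw [← hc, hq, Polynomial.eval₂_finsetSum]
      simp
    have hqz : q = 0 := by
      by_contra hne
      have h1 := hmin q hne hq0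
      have h2 : q.degree < k := Polynomial.degree_sum_fin_lt _
      rw [Polynomial.degree_eq_natDegree hne] at h2
      exact absurd (Nat.cast_lt.1 h2) (not_lt.2 h1)
    funext i
    have h1 := congrArg (fun r => Polynomial.coeff r i) hqz
    simp only [hq, Polynomial.finsetSum_coeff, Polynomial.coeff_C_mul, Polynomial.coeff_X_pow,
      Polynomial.coeff_zero, Fin.val_inj, mul_ite, mul_one, mul_zero, Finset.sum_ite_eq,
      Finset.mem_univ, if_true] at h1
    exact Subtype.ext h1
  have := LinearMap.finrank_le_finrank_of_injective hLinj
  rwa [Module.finrank_pi_fintype, Finset.sum_const, Finset.card_univ, Fintype.card_fin,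
    smul_eq_mul] at this

/-- The `k`-th coefficient of `p` is homogeneous of degree `D - k`. -/
def IsBihomogeneous {σ : Type*} (D : ℕ) (p : (MvPolynomial σ ℂ)[X]) : Prop :=
  ∀ k, (k ≤ D → (p.coeff k).IsHomogeneous (D - k)) ∧ (D < k → p.coeff k = 0)

theorem IsBihomogeneous.mul {σ : Type*} {D E : ℕ} {p q : (MvPolynomial σ ℂ)[X]}
    (hp : IsBihomogeneous D p) (hq : IsBihomogeneous E q) : IsBihomogeneous (D + E) (p * q) := by
  intro k
  constructor
  · intro hk
    rw [Polynomial.coeff_mul]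
    refine MvPolynomial.IsHomogeneous.sum _ _ _ fun ij hij => ?_
    rw [Finset.HasAntidiagonal.mem_antidiagonal] at hij
    rcases lt_or_ge D ij.1 with h | h
    · rw [(hp _).2 h, zero_mul]
      exact MvPolynomial.isHomogeneous_zero _ _ _
    rcases lt_or_ge E ij.2 with h' | h'
    · rw [(hq _).2 h', mul_zero]
      exact MvPolynomial.isHomogeneous_zero _ _ _
    have := ((hp _).1 h).mul ((hq _).1 h')
    rwa [show D - ij.1 + (E - ij.2) = D + E - k by omega] at this
  · intro hk
    rw [Polynomial.coeff_mul]
    refine Finset.sum_eq_zero fun ij hij => ?_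
    rw [Finset.HasAntidiagonal.mem_antidiagonal] at hij
    rcases lt_or_ge D ij.1 with h | h
    · rw [(hp _).2 h, zero_mul]
    · rw [(hq _).2 (by omega), mul_zero]

theorem isBihomogeneous_X {σ : Type*} :
    IsBihomogeneous 1 (X : (MvPolynomial σ ℂ)[X]) := by
  intro k
  rw [coeff_X]
  constructor
  · intro hk
    split_ifs with h
    · subst h
      exact MvPolynomial.isHomogeneous_one _ _
    · exact MvPolynomial.isHomogeneous_zero _ _ _
  · intro hk
    rw [if_neg (by omega)]

theorem isBihomogeneous_X_sub_C {σ : Type*} (i : σ) :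
    IsBihomogeneous 1 (X - C (MvPolynomial.X i) : (MvPolynomial σ ℂ)[X]) := by
  intro k
  rw [coeff_sub, coeff_C]
  refine ⟨fun hk => MvPolynomial.IsHomogeneous.sub ((isBihomogeneous_X k).1 hk) ?_, fun hk => ?_⟩
  · split_ifs with h
    · subst h
      exact MvPolynomial.isHomogeneous_X _ _
    · exact MvPolynomial.isHomogeneous_zero _ _ _
  · rw [(isBihomogeneous_X k).2 hk, if_neg (by omega), sub_zero]

theorem isBihomogeneous_prod {σ ι : Type*} (s : Finset ι) (f : ι → σ) :
    IsBihomogeneous s.card (∏ i ∈ s, (X - C (MvPolynomial.X (f i))) : (MvPolynomial σ ℂ)[X]) := by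
  classical
  induction s using Finset.induction_on with
  | empty =>
    intro k
    rw [Finset.prod_empty, coeff_one, Finset.card_empty]
    refine ⟨fun hk => ?_, fun hk => if_neg (by omega)⟩
    rw [if_pos (by omega), show k = 0 by omega]
    exact MvPolynomial.isHomogeneous_one _ _
  | insert a s ha ih =>
    rw [Finset.prod_insert ha, Finset.card_insert_of_notMem ha, add_comm]
    exact (isBihomogeneous_X_sub_C _).mul ih

/-- The primitive, vanishing at `0`, of a polynomial of degree less than `d`. -/
noncomputable def primitive (d : ℕ) (r : ℂ[X]) : ℂ[X] :=
  ∑ k ∈ Finset.range d, C (r.coeff k / (k + 1)) * X ^ (k + 1)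

theorem eval_zero_primitive (d : ℕ) (r : ℂ[X]) : (primitive d r).eval 0 = 0 := by
  simp [primitive, eval_finsetSum]

theorem derivative_primitive {d : ℕ} {r : ℂ[X]} (hr : r.natDegree < d) :
    (primitive d r).derivative = r := by
  conv_rhs => rw [r.as_sum_range_C_mul_X_pow' hr]
  rw [primitive, derivative_sum]
  refine Finset.sum_congr rfl fun k _ => ?_
  rw [derivative_C_mul_X_pow]
  have : (k : ℂ) + 1 ≠ 0 := Nat.cast_add_one_ne_zero k
  simp [div_mul_cancel₀ _ this]

theorem eq_of_derivative_eq {p q : ℂ[X]} (h : p.derivative = q.derivative) {x : ℂ}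
    (hx : p.eval x = q.eval x) : p = q := by
  have h1 : (p - q).derivative = 0 := by rw [derivative_sub, h, sub_self]
  have h2 := eq_C_of_natDegree_eq_zero (derivative_eq_zero.1 h1)
  have h3 : (p - q).eval x = 0 := by rw [eval_sub, hx, sub_self]
  rw [h2, eval_C] at h3
  rw [h3, C_0] at h2
  exact sub_eq_zero.1 h2

/-- If every critical point of `q` is a root of `q`, then `q` has at most one critical point. -/
theorem card_roots_derivative_le_one {q : ℂ[X]} (hq : q ≠ 0)
    (h : ∀ z ∈ q.derivative.roots, q.IsRoot z) : q.derivative.roots.toFinset.card ≤ 1 := by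
  classical
  by_cases hd : q.derivative = 0
  · simp [hd]
  have h1 : ∀ z ∈ q.derivative.roots.toFinset,
      q.roots.count z = q.derivative.roots.count z + 1 := by
    intro z hz
    have hz' := h z (Multiset.mem_toFinset.1 hz)
    rw [count_roots, count_roots, derivative_rootMultiplicity_of_root hz',
      Nat.sub_add_cancel ((rootMultiplicity_pos hq).2 hz')]
  have h2 : q.derivative.roots.toFinset ⊆ q.roots.toFinset := fun z hz =>
    Multiset.mem_toFinset.2 ((mem_roots hq).2 (h z (Multiset.mem_toFinset.1 hz)))
  have h3 : ∑ z ∈ q.derivative.roots.toFinset, q.roots.count z ≤ q.natDegree :=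
    calc _ ≤ ∑ z ∈ q.roots.toFinset, q.roots.count z := Finset.sum_le_sum_of_subset h2
      _ = q.roots.card := Multiset.toFinset_sum_count_eq _
      _ ≤ _ := q.card_roots'
  rw [Finset.sum_congr rfl h1, Finset.sum_add_distrib, Multiset.toFinset_sum_count_eq,
    Finset.sum_const, smul_eq_mul, mul_one,
    splits_iff_card_roots.1 (IsAlgClosed.splits q.derivative), natDegree_derivative] at h3
  have : q.natDegree ≠ 0 := fun h0 => hd (by
    rw [eq_C_of_natDegree_eq_zero h0, derivative_C])
  omega

theorem exists_list_map_eq {α β : Type*} {f : α → β} :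
    ∀ {L : List β} {R : Multiset α}, R.map f = (L : Multiset β) →
      ∃ L' : List α, R = L' ∧ L'.map f = L
  | [], R, h => ⟨[], by simpa using h, rfl⟩
  | b :: L, R, h => by
    classical
    rw [← Multiset.cons_coe] at h
    obtain ⟨a, ha, hab, hR⟩ := (Multiset.map_eq_cons f R L b).2 h
    obtain ⟨L', hL', hL''⟩ := exists_list_map_eq hR
    refine ⟨a :: L', ?_, by simp [hab, hL'']⟩
    rw [← Multiset.cons_coe, ← hL', Multiset.cons_erase ha]

theorem exists_fun_map_eq {α β : Type*} {m : ℕ} {f : α → β} {R : Multiset α} {v : Fin m → β}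
    (h : R.map f = Finset.univ.val.map v) :
    ∃ z : Fin m → α, R = Finset.univ.val.map z ∧ ∀ i, f (z i) = v i := by
  rw [Fin.univ_val_map] at h
  obtain ⟨L', rfl, hL'⟩ := exists_list_map_eq h
  have hlen : L'.length = m := by
    have := congrArg List.length hL'
    simpa using this
  subst hlen
  refine ⟨L'.get, by rw [Fin.univ_val_map, List.ofFn_get], fun i => ?_⟩
  have := congrArg (fun l => l[(i : ℕ)]?) hL'
  simpa using this

theorem exists_fun_eq_map {α : Type*} {m : ℕ} {R : Multiset α} (h : R.card = m) :
    ∃ z : Fin m → α, R = Finset.univ.val.map z := by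
  subst h
  exact ⟨fun i => R.toList.get (i.cast (Multiset.length_toList R).symm), by
    rw [Fin.univ_val_map]
    conv_lhs => rw [← Multiset.coe_toList R]
    congr 1
    refine List.ext_get (by simp) fun k _ _ => by simp⟩

theorem coeff_mcPoly (d : ℕ) (a : Fin (d - 1) → ℂ) (k : ℕ) :
    (mcPoly d a).coeff k =
      (if k = d then 1 else 0) + if h : k < d - 1 then a ⟨k, h⟩ else 0 := by
  rw [mcPoly, coeff_add, coeff_X_pow, finsetSum_coeff]
  congr 1
  split_ifs with h
  · rw [Finset.sum_eq_single ⟨k, h⟩]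
    · simp
    · intro b _ hb
      rw [coeff_C_mul_X_pow, if_neg fun h' => hb (Fin.ext h'.symm)]
    · simp
  · refine Finset.sum_eq_zero fun i _ => ?_
    rw [coeff_C_mul_X_pow, if_neg fun h' => h (by rw [h']; exact i.2)]

theorem coeff_mcPoly_fin (d : ℕ) (a : Fin (d - 1) → ℂ) (i : Fin (d - 1)) :
    (mcPoly d a).coeff i = a i := by
  have := i.2
  rw [coeff_mcPoly, if_neg (by omega), dif_pos this, zero_add]

theorem mcPoly_injective (d : ℕ) : Function.Injective (mcPoly d) := fun a b h => by
  ext i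
  rw [← coeff_mcPoly_fin d a, ← coeff_mcPoly_fin d b, h]

theorem natDegree_mcPoly {d : ℕ} (a : Fin (d - 1) → ℂ) : (mcPoly d a).natDegree = d := by
  refine natDegree_eq_of_le_of_coeff_ne_zero ?_ ?_
  · rw [natDegree_le_iff_coeff_eq_zero]
    intro k hk
    rw [coeff_mcPoly, if_neg (by omega), dif_neg (by omega), zero_add]
  · rw [coeff_mcPoly, if_pos rfl, dif_neg (by omega), add_zero]
    exact one_ne_zero

theorem natDegree_derivative_mcPoly {d : ℕ} (a : Fin (d - 1) → ℂ) :
    (mcPoly d a).derivative.natDegree = d - 1 := by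
  rw [natDegree_derivative, natDegree_mcPoly]

theorem leadingCoeff_derivative_mcPoly {d : ℕ} (hd : 1 ≤ d) (a : Fin (d - 1) → ℂ) :
    (mcPoly d a).derivative.leadingCoeff = d := by
  rw [leadingCoeff, natDegree_derivative_mcPoly, coeff_derivative, Nat.sub_add_cancel hd,
    coeff_mcPoly, if_pos rfl, dif_neg (by omega), ← Nat.cast_add_one, Nat.sub_add_cancel hd]
  simp

theorem card_roots_derivative_mcPoly {d : ℕ} (a : Fin (d - 1) → ℂ) :
    (mcPoly d a).derivative.roots.card = d - 1 := by
  rw [splits_iff_card_roots.1 (IsAlgClosed.splits _), natDegree_derivative_mcPoly]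

theorem derivative_mcPoly_eq_prod {d : ℕ} (hd : 1 ≤ d) (a : Fin (d - 1) → ℂ)
    {z : Fin (d - 1) → ℂ} (hz : (mcPoly d a).derivative.roots = Finset.univ.val.map z) :
    (mcPoly d a).derivative = C (d : ℂ) * ∏ i, (X - C (z i)) := by
  conv_lhs => rw [(IsAlgClosed.splits (mcPoly d a).derivative).eq_prod_roots,
    leadingCoeff_derivative_mcPoly hd, hz, Multiset.map_map]
  rfl

theorem sum_roots_derivative_mcPoly {d : ℕ} (hd : 2 ≤ d) (a : Fin (d - 1) → ℂ)
    {z : Fin (d - 1) → ℂ} (hz : (mcPoly d a).derivative.roots = Finset.univ.val.map z) :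
    ∑ i, z i = 0 := by
  have h1 := congrArg (fun q : ℂ[X] => q.coeff (d - 2))
    (derivative_mcPoly_eq_prod (by omega) a hz)
  have h2 := prod_X_sub_C_coeff_card_pred (Finset.univ : Finset (Fin (d - 1))) z (by simp; omega)
  rw [Finset.card_univ, Fintype.card_fin, show d - 1 - 1 = d - 2 by omega] at h2
  have h3 : (mcPoly d a).coeff (d - 2 + 1) = 0 := by
    rw [coeff_mcPoly, if_neg (by omega), dif_neg (by omega), add_zero]
  simp only [coeff_derivative, coeff_C_mul, h2, h3, zero_mul] at h1
  have hd0 : (d : ℂ) ≠ 0 := Nat.cast_ne_zero.2 (by omega)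
  simpa [hd0] using h1.symm

/-- The values at `w j` of the primitive of `(n + 2) X ∏ (X - w i)`, as polynomials in `w`. -/
noncomputable def criticalForm (n : ℕ) (j : Fin n) : MvPolynomial (Fin n) ℂ :=
  ∑ k ∈ Finset.range (n + 2), MvPolynomial.C (((n + 2 : ℕ) : ℂ) / (k + 1)) *
    (X * ∏ i : Fin n, (X - C (MvPolynomial.X i)) : (MvPolynomial (Fin n) ℂ)[X]).coeff k *
      MvPolynomial.X j ^ (k + 1)

theorem isHomogeneous_criticalForm (n : ℕ) (j : Fin n) :
    (criticalForm n j).IsHomogeneous (n + 2) := by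
  refine MvPolynomial.IsHomogeneous.sum _ _ _ fun k hk => ?_
  rw [Finset.mem_range] at hk
  have h1 := (isBihomogeneous_X.mul (isBihomogeneous_prod (Finset.univ : Finset (Fin n)) id)) k
  rw [Finset.card_univ, Fintype.card_fin] at h1
  have h2 := ((MvPolynomial.isHomogeneous_C (Fin n) (((n + 2 : ℕ) : ℂ) / (k + 1))).mul
    (h1.1 (by omega))).mul ((MvPolynomial.isHomogeneous_X ℂ j).pow (k + 1))
  rwa [show 0 + (1 + n - k) + 1 * (k + 1) = n + 2 by omega] at h2

theorem eval_criticalForm (n : ℕ) (j : Fin n) (w : Fin n → ℂ) :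
    MvPolynomial.eval w (criticalForm n j) =
      (primitive (n + 2) (C ((n + 2 : ℕ) : ℂ) * (X * ∏ i, (X - C (w i))))).eval (w j) := by
  have h : (X * ∏ i, (X - C (w i)) : ℂ[X]) =
      (X * ∏ i : Fin n, (X - C (MvPolynomial.X i)) : (MvPolynomial (Fin n) ℂ)[X]).map
        (MvPolynomial.eval w) := by
    simp [Polynomial.map_prod]
  rw [h, criticalForm, primitive, eval_finsetSum, map_sum]
  refine Finset.sum_congr rfl fun k _ => ?_
  rw [map_mul, map_mul, map_pow, MvPolynomial.eval_C, MvPolynomial.eval_X, eval_C_mul,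
    eval_pow, eval_X, coeff_C_mul, coeff_map]
  ring

theorem natDegree_X_mul_prod (n : ℕ) (w : Fin n → ℂ) :
    (C ((n + 2 : ℕ) : ℂ) * (X * ∏ i, (X - C (w i)))).natDegree = n + 1 := by
  have h : (∏ i, (X - C (w i)) : ℂ[X]).Monic := monic_prod_of_monic _ _ fun i _ => monic_X_sub_C _
  rw [natDegree_C_mul (Nat.cast_ne_zero.2 (by omega)), natDegree_X_mul h.ne_zero,
    natDegree_prod_of_monic _ _ fun i _ => monic_X_sub_C _]
  simp

theorem eq_zero_of_eval_criticalForm {n : ℕ} {w : Fin n → ℂ}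
    (hw : ∀ j, MvPolynomial.eval w (criticalForm n j) = 0) : w = 0 := by
  set r := C ((n + 2 : ℕ) : ℂ) * (X * ∏ i, (X - C (w i))) with hr
  have hn : ((n + 2 : ℕ) : ℂ) ≠ 0 := Nat.cast_ne_zero.2 (by omega)
  have hdeg : r.natDegree = n + 1 := natDegree_X_mul_prod n w
  have hder : (primitive (n + 2) r).derivative = r := derivative_primitive (by omega)
  have hr0 : r ≠ 0 := fun h => by simp [h] at hdeg
  have hroot : ∀ z, r.IsRoot z ↔ z = 0 ∨ ∃ j, z = w j := fun z => by
    simp only [hr, IsRoot, eval_mul, eval_C, eval_X, eval_prod, eval_sub, mul_eq_zero, hn,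
      false_or, Finset.prod_eq_zero_iff, Finset.mem_univ, true_and, sub_eq_zero]
  have hcard := card_roots_derivative_le_one (q := primitive (n + 2) r)
    (fun h => hr0 (by rw [← hder, h, derivative_zero])) (by
      rw [hder]
      intro z hz
      rcases (hroot z).1 (isRoot_of_mem_roots hz) with rfl | ⟨j, rfl⟩
      · exact eval_zero_primitive _ _
      · rw [IsRoot, ← eval_criticalForm, hw])
  rw [hder, Finset.card_le_one] at hcard
  ext j
  exact hcard _ (by simpa [hr0] using (hroot _).2 (Or.inr ⟨j, rfl⟩)) _
    (by simpa [hr0] using (hroot _).2 (Or.inl rfl))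

theorem mcPoly_comp_eq_primitive {n : ℕ} {a : Fin (n + 1) → ℂ} {z : Fin (n + 1) → ℂ}
    (hz : (mcPoly (n + 2) a).derivative.roots = Finset.univ.val.map z) :
    (mcPoly (n + 2) a).comp (X + C (z 0)) =
      primitive (n + 2) (C ((n + 2 : ℕ) : ℂ) * (X * ∏ i : Fin n, (X - C (z i.succ - z 0)))) +
        C ((mcPoly (n + 2) a).eval (z 0)) := by
  refine eq_of_derivative_eq (x := 0) ?_ ?_
  · rw [derivative_comp, derivative_add, derivative_C, add_zero, derivative_add, derivative_C, add_zero,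
      derivative_primitive (by rw [natDegree_X_mul_prod]; omega),
      derivative_mcPoly_eq_prod (d := n + 2) (by omega) a hz]
    simp only [derivative_X, one_mul, mul_comp, C_comp,
      prod_comp, sub_comp, X_comp]
    erw [Fin.prod_univ_succ]
    simp only [add_sub_cancel_right, C_sub, sub_sub_eq_add_sub]
  · simp [eval_zero_primitive]

theorem card_fibre_le_aux {n : ℕ} (M : Multiset ℂ) (s : Finset (Fin (n + 1) → ℂ))
    (hs : ∀ a ∈ s, cvl (mcPoly (n + 2) a) = M) : s.card ≤ (n + 2) ^ n := by
  classical
  rcases s.eq_empty_or_nonempty with rfl | ⟨a₁, ha₁⟩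
  · simp
  have hM : M.card = n + 1 := by
    rw [← hs a₁ ha₁, cvl, Multiset.card_map, card_roots_derivative_mcPoly]
    rfl
  obtain ⟨v, rfl⟩ := exists_fun_eq_map hM
  have hz : ∀ a, ∃ z : Fin (n + 1) → ℂ, a ∈ s →
      (mcPoly (n + 2) a).derivative.roots = Finset.univ.val.map z ∧
        ∀ i, (mcPoly (n + 2) a).eval (z i) = v i := by
    intro a
    by_cases ha : a ∈ s
    · obtain ⟨z, hz⟩ := exists_fun_map_eq (hs a ha)
      exact ⟨z, fun _ => hz⟩
    · exact ⟨0, fun h => absurd h ha⟩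
  choose z hz using hz
  have hinj : Set.InjOn (fun a (j : Fin n) => z a j.succ - z a 0) s := by
    intro a ha b hb hab
    obtain ⟨ha1, ha2⟩ := hz a ha
    obtain ⟨hb1, hb2⟩ := hz b hb
    have hab' : ∀ j : Fin n, z a j.succ - z a 0 = z b j.succ - z b 0 := congrFun hab
    have hsum : ∀ c ∈ s, (n + 1 : ℂ) * z c 0 = - ∑ j : Fin n, (z c j.succ - z c 0) := by
      intro c hc
      have h := sum_roots_derivative_mcPoly (d := n + 2) (by omega) c (hz c hc).1
      erw [Fin.sum_univ_succ] at h
      rw [Finset.sum_sub_distrib, Finset.sum_const, Finset.card_univ, Fintype.card_fin,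
        nsmul_eq_mul]
      linear_combination h
    have h0 : z a 0 = z b 0 := by
      refine mul_left_cancel₀ (Nat.cast_add_one_ne_zero n) ?_
      rw [hsum a ha, hsum b hb, Finset.sum_congr rfl fun j _ => hab' j]
    have h1 := mcPoly_comp_eq_primitive ha1
    have h2 := mcPoly_comp_eq_primitive hb1
    simp only [hab', ha2] at h1
    rw [h0] at h1
    rw [hb2, ← h1] at h2
    have h3 := congrArg (fun q : ℂ[X] => q.comp (X - C (z b 0))) h2
    simp only [comp_assoc, add_comp, X_comp, C_comp, sub_add_cancel, comp_X] at h3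
    exact (mcPoly_injective (n + 2) h3).symm
  rw [← Finset.card_image_of_injOn hinj]
  refine card_le_pow_of_homogeneous (by omega) (isHomogeneous_criticalForm n)
    (fun w => eq_zero_of_eval_criticalForm) (fun j => v j.succ - v 0) _ fun w hw j => ?_
  obtain ⟨a, ha, rfl⟩ := Finset.mem_image.1 hw
  obtain ⟨h1, h2⟩ := hz a ha
  have h := congrArg (eval (z a j.succ - z a 0)) (mcPoly_comp_eq_primitive h1)
  rw [eval_add, eval_C, eval_comp, eval_add, eval_X, eval_C, sub_add_cancel, h2, h2] at h
  rw [eval_criticalForm, h, add_sub_cancel_right]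

/-- At most `d ^ (d - 2)` monic centered polynomials share a critical value multiset. -/
theorem card_fibre_le {d : ℕ} (hd : 2 ≤ d) (M : Multiset ℂ) (s : Finset (Fin (d - 1) → ℂ))
    (hs : ∀ a ∈ s, cvl (mcPoly d a) = M) : s.card ≤ d ^ (d - 2) := by
  obtain ⟨n, rfl⟩ := Nat.exists_eq_add_of_le' hd
  exact card_fibre_le_aux M s hs

/-- Families of complex numbers converging along `l`, paired with their limit. -/
def limAlgebra {ι : Type*} (l : Filter ι) : Subalgebra ℂ ((ι → ℂ) × ℂ) where
  carrier := {x | Filter.Tendsto x.1 l (nhds x.2)}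
  mul_mem' ha hb := Filter.Tendsto.mul ha hb
  add_mem' ha hb := Filter.Tendsto.add ha hb
  algebraMap_mem' _ := tendsto_const_nhds

/-- The limit of a convergent family. -/
def limHom {ι : Type*} (l : Filter ι) : limAlgebra l →+* ℂ :=
  (RingHom.snd (ι → ℂ) ℂ).comp (limAlgebra l).subtype

/-- The member of index `k` of a convergent family. -/
def termHom {ι : Type*} (l : Filter ι) (k : ι) : limAlgebra l →+* ℂ :=
  (Pi.evalRingHom (fun _ => ℂ) k).comp ((RingHom.fst (ι → ℂ) ℂ).comp (limAlgebra l).subtype)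

/-- A convergent family as an element of `limAlgebra l`. -/
def limMk {ι : Type*} {l : Filter ι} (u : ι → ℂ) (L : ℂ) (h : Filter.Tendsto u l (nhds L)) :
    limAlgebra l := ⟨(u, L), h⟩

@[simp] theorem limHom_limMk {ι : Type*} {l : Filter ι} {u : ι → ℂ} {L : ℂ}
    (h : Filter.Tendsto u l (nhds L)) : limHom l (limMk u L h) = L := rfl

@[simp] theorem termHom_limMk {ι : Type*} {l : Filter ι} {u : ι → ℂ} {L : ℂ}
    (h : Filter.Tendsto u l (nhds L)) (k : ι) : termHom l k (limMk u L h) = u k := rfl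

@[simp] theorem limHom_algebraMap {ι : Type*} {l : Filter ι} (c : ℂ) :
    limHom l (algebraMap ℂ (limAlgebra l) c) = c := rfl

@[simp] theorem termHom_algebraMap {ι : Type*} {l : Filter ι} (c : ℂ) (k : ι) :
    termHom l k (algebraMap ℂ (limAlgebra l) c) = c := rfl

theorem tendsto_termHom {ι : Type*} {l : Filter ι} (x : limAlgebra l) :
    Filter.Tendsto (fun k => termHom l k x) l (nhds (limHom l x)) := x.2

theorem map_limHom_eq_zero {ι : Type*} {l : Filter ι} [l.NeBot] {p : (limAlgebra l)[X]}
    (h : ∀ᶠ k in l, p.map (termHom l k) = 0) : p.map (limHom l) = 0 := by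
  ext i
  rw [coeff_map, coeff_zero]
  refine tendsto_nhds_unique (tendsto_termHom (p.coeff i)) (tendsto_const_nhds.congr' ?_)
  filter_upwards [h] with k hk
  rw [← coeff_map, hk, coeff_zero]

/-- Divisibility by a monic polynomial passes to the limit. -/
theorem map_limHom_dvd {ι : Type*} {l : Filter ι} [l.NeBot] {m p : (limAlgebra l)[X]}
    (hm : m.Monic) (h : ∀ᶠ k in l, m.map (termHom l k) ∣ p.map (termHom l k)) :
    m.map (limHom l) ∣ p.map (limHom l) := by
  rw [← modByMonic_eq_zero_iff_dvd (hm.map _), ← map_modByMonic _ hm]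
  refine map_limHom_eq_zero ?_
  filter_upwards [h] with k hk
  rwa [map_modByMonic _ hm, modByMonic_eq_zero_iff_dvd (hm.map _)]

/-- A polynomial vanishing at the critical values of `p` pulls back to a multiple of `p'`. -/
theorem derivative_dvd_comp {p W : ℂ[X]} (hp : p.derivative ≠ 0)
    (h : ∀ z, p.derivative.IsRoot z → W.IsRoot (p.eval z)) : p.derivative ∣ W.comp p := by
  by_cases hW : W.comp p = 0
  · rw [hW]
    exact dvd_zero _
  classical
  rw [IsAlgClosed.dvd_iff_roots_le_roots hp hW, Multiset.le_iff_count]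
  intro z
  rw [count_roots, count_roots]
  by_cases hz : p.derivative.IsRoot z
  · have hroot : (W.comp p).IsRoot z := by
      rw [IsRoot, eval_comp]
      exact h z hz
    by_cases h0 : (W.comp p).derivative = 0
    · have h1 := derivative_eq_zero.1 h0
      rw [eq_C_of_natDegree_eq_zero h1, IsRoot, eval_C] at hroot
      rw [eq_C_of_natDegree_eq_zero h1, hroot, C_0] at hW
      exact absurd rfl hW
    · have h1 := derivative_rootMultiplicity_of_root hroot
      have h2 := rootMultiplicity_le_rootMultiplicity_of_dvd h0
        (Dvd.intro _ (derivative_comp W p).symm) z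
      omega
  · rw [rootMultiplicity_eq_zero hz]
    exact Nat.zero_le _

theorem derivative_dvd_of_sq_dvd {P W δ : ℂ[X]} (hP : P.derivative ≠ 0)
    (hW : ∀ z, P.derivative.IsRoot z → W.IsRoot (P.eval z) ∧ W.derivative.eval (P.eval z) ≠ 0)
    (h : P.derivative * P.derivative ∣ δ * (W.comp P).derivative - δ.derivative * W.comp P) :
    P.derivative ∣ δ := by
  by_cases hδ : δ = 0
  · rw [hδ]
    exact dvd_zero _
  classical
  rw [IsAlgClosed.dvd_iff_roots_le_roots hP hδ, Multiset.le_iff_count]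
  intro z
  rw [count_roots, count_roots]
  by_contra! hlt
  set m := P.derivative.rootMultiplicity z with hm
  set o := δ.rootMultiplicity z with ho
  have hz : P.derivative.IsRoot z := (rootMultiplicity_pos hP).1 (by omega)
  obtain ⟨hW1, hW2⟩ := hW z hz
  set U := W.comp P with hU
  have hUz : U.IsRoot z := by rwa [IsRoot, hU, eval_comp]
  have hWP : ¬ (W.derivative.comp P).IsRoot z := by rwa [IsRoot, eval_comp]
  have hWP0 : W.derivative.comp P ≠ 0 := fun h0 => hWP (by rw [h0, IsRoot, eval_zero])
  have hU' : U.derivative = P.derivative * W.derivative.comp P := derivative_comp W P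
  have hU'0 : U.derivative ≠ 0 := by
    rw [hU']
    exact mul_ne_zero hP hWP0
  have hU0 : U ≠ 0 := fun h0 => hU'0 (by rw [h0, derivative_zero])
  have hUm : U.rootMultiplicity z = m + 1 := by
    have h1 := derivative_rootMultiplicity_of_root hUz
    rw [hU', rootMultiplicity_mul (hU' ▸ hU'0), rootMultiplicity_eq_zero hWP, add_zero] at h1
    have := (rootMultiplicity_pos hU0).2 hUz
    omega
  obtain ⟨U1, hU1, hU1z⟩ := exists_eq_pow_rootMultiplicity_mul_and_not_dvd U hU0 z
  obtain ⟨δ1, hδ1, hδ1z⟩ := exists_eq_pow_rootMultiplicity_mul_and_not_dvd δ hδ z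
  rw [hUm] at hU1
  rw [← ho] at hδ1
  rw [dvd_iff_isRoot, IsRoot] at hU1z hδ1z
  have hdU : (X - C z) * U.derivative =
      (X - C z) ^ (m + 1) * (((m + 1 : ℕ) : ℂ[X]) * U1 + (X - C z) * U1.derivative) := by
    rw [hU1, derivative_mul, derivative_X_sub_C_pow, Nat.add_sub_cancel, map_natCast]
    ring
  have hdδ : (X - C z) * δ.derivative =
      (X - C z) ^ o * ((o : ℂ[X]) * δ1 + (X - C z) * δ1.derivative) := by
    conv_lhs => rw [hδ1, derivative_mul, derivative_X_sub_C_pow]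
    rcases o with _ | o
    · simp
    · rw [Nat.add_sub_cancel]
      simp only [map_natCast]
      ring
  have hPd : (X - C z) ^ m ∣ P.derivative := pow_rootMultiplicity_dvd _ _
  have h2 : (X - C z) ^ (o + m + 1) * (X - C z) ∣
      (X - C z) * (δ * U.derivative - δ.derivative * U) := by
    refine Dvd.dvd.trans ?_ (mul_dvd_mul_left _ ((mul_dvd_mul hPd hPd).trans h))
    rw [← pow_add, ← pow_succ, ← pow_succ']
    exact pow_dvd_pow _ (by omega)
  have h3 : (X - C z) * (δ * U.derivative - δ.derivative * U) = (X - C z) ^ (o + m + 1) *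
      ((((m + 1 : ℕ) : ℂ[X]) - (o : ℂ[X])) * (δ1 * U1) +
        (X - C z) * (δ1 * U1.derivative - δ1.derivative * U1)) := by
    have : (X - C z) * (δ * U.derivative - δ.derivative * U) =
      δ * ((X - C z) * U.derivative) - ((X - C z) * δ.derivative) * U := by ring
    rw [this, hdU, hdδ]
    conv_lhs => rw [hδ1, hU1]
    ring
  rw [h3] at h2
  have h4 := (mul_dvd_mul_iff_left (pow_ne_zero _ (X_sub_C_ne_zero z))).1 h2
  rw [dvd_iff_isRoot, IsRoot] at h4
  simp only [eval_add, eval_mul, eval_sub, eval_X, eval_C, sub_self, zero_mul, add_zero,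
    eval_natCast, mul_eq_zero, hU1z, hδ1z, or_false, sub_eq_zero, Nat.cast_inj] at h4
  omega

theorem continuous_eval_mcPoly (d : ℕ) :
    Continuous fun x : (Fin (d - 1) → ℂ) × ℂ => (mcPoly d x.1).eval x.2 := by
  simp only [mcPoly, eval_add, eval_pow, eval_X, eval_finsetSum, eval_mul, eval_C]
  fun_prop

theorem continuous_eval_derivative_mcPoly (d : ℕ) (z : ℂ) :
    Continuous fun a : Fin (d - 1) → ℂ => (mcPoly d a).derivative.eval z := by
  simp only [mcPoly, derivative_add, derivative_X_pow, derivative_sum, derivative_C_mul_X_pow,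
    eval_add, eval_finsetSum, eval_mul, eval_pow, eval_X, eval_C]
  fun_prop

theorem exists_root_derivative_close {d : ℕ} (hd : 2 ≤ d) (a : Fin (d - 1) → ℂ) (z : ℂ) :
    ∃ y ∈ (mcPoly d a).derivative.roots,
      ‖y - z‖ ^ (d - 1) ≤ ‖(mcPoly d a).derivative.eval z‖ := by
  obtain ⟨w, hw⟩ := exists_fun_eq_map (card_roots_derivative_mcPoly a)
  have : Nonempty (Fin (d - 1)) := ⟨⟨0, by omega⟩⟩
  obtain ⟨i, -, hi⟩ := Finset.exists_min_image Finset.univ (fun i => ‖w i - z‖)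
    Finset.univ_nonempty
  refine ⟨w i, by rw [hw]; exact Multiset.mem_map_of_mem _ (Finset.mem_univ i), ?_⟩
  rw [derivative_mcPoly_eq_prod (by omega) a hw, eval_mul, eval_C, eval_prod, norm_mul, norm_prod]
  have h1 : ‖w i - z‖ ^ (d - 1) ≤ ∏ j, ‖eval z (X - C (w j))‖ := by
    calc ‖w i - z‖ ^ (d - 1) = ∏ _j : Fin (d - 1), ‖w i - z‖ := by simp
      _ ≤ _ := Finset.prod_le_prod (fun _ _ => norm_nonneg _) fun j hj => by
        rw [eval_sub, eval_X, eval_C, norm_sub_rev z]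
        exact hi j hj
  have h2 : (1 : ℝ) ≤ ‖(d : ℂ)‖ := by
    rw [Complex.norm_natCast]
    exact_mod_cast (by omega : 1 ≤ d)
  exact h1.trans (le_mul_of_one_le_left (Finset.prod_nonneg fun _ _ => norm_nonneg _) h2)

/-- Every critical value of a limit polynomial is a limit of critical values. -/
theorem exists_tendsto_of_mem_cvl {ι : Type*} {l : Filter ι} {d : ℕ} (hd : 2 ≤ d)
    {a : ι → Fin (d - 1) → ℂ} {c : Fin (d - 1) → ℂ} (ha : Filter.Tendsto a l (nhds c))
    {x : ℂ} (hx : x ∈ cvl (mcPoly d c)) :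
    ∃ v : ι → ℂ, (∀ k, v k ∈ cvl (mcPoly d (a k))) ∧ Filter.Tendsto v l (nhds x) := by
  obtain ⟨z, hz, rfl⟩ := Multiset.mem_map.1 hx
  choose y hy hyz using fun k => exists_root_derivative_close hd (a k) z
  refine ⟨fun k => (mcPoly d (a k)).eval (y k), fun k => Multiset.mem_map_of_mem _ (hy k), ?_⟩
  have h1 : Filter.Tendsto (fun k => ‖(mcPoly d (a k)).derivative.eval z‖) l (nhds 0) := by
    have := ((continuous_eval_derivative_mcPoly d z).tendsto c).comp ha
    rw [show (mcPoly d c).derivative.eval z = 0 from isRoot_of_mem_roots hz] at this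
    simpa using this.norm
  have h2 : Filter.Tendsto (fun k => ‖y k - z‖ ^ (d - 1)) l (nhds 0) :=
    squeeze_zero (fun k => by positivity) hyz h1
  have h3 : Filter.Tendsto (fun k => ‖y k - z‖) l (nhds 0) := by
    have hd1 : d - 1 ≠ 0 := by omega
    have h := h2.rpow_const (p := ((d - 1 : ℕ) : ℝ)⁻¹) (Or.inr (by positivity))
    rw [Real.zero_rpow (by positivity)] at h
    exact h.congr fun k => Real.pow_rpow_inv_natCast (norm_nonneg _) hd1
  have h4 : Filter.Tendsto y l (nhds z) := tendsto_iff_norm_sub_tendsto_zero.2 h3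
  exact ((continuous_eval_mcPoly d).tendsto (c, z)).comp (ha.prodMk_nhds h4)

/-- If the number of critical values does not drop in the limit, then near the limit the critical
values form convergent families with distinct limits. -/
theorem exists_tendsto_cvl {ι : Type*} {l : Filter ι} {d : ℕ} (hd : 2 ≤ d)
    {a : ι → Fin (d - 1) → ℂ} {c : Fin (d - 1) → ℂ} (ha : Filter.Tendsto a l (nhds c))
    (hcard : ∀ᶠ k in l, (cvl (mcPoly d (a k))).toFinset.card ≤
      (cvl (mcPoly d c)).toFinset.card) :
    ∃ v : ℂ → ι → ℂ, (∀ x ∈ (cvl (mcPoly d c)).toFinset, Filter.Tendsto (v x) l (nhds x)) ∧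
      ∀ᶠ k in l, ∀ y ∈ cvl (mcPoly d (a k)), ∃ x ∈ (cvl (mcPoly d c)).toFinset, v x k = y := by
  have hv : ∀ x, ∃ v : ι → ℂ, x ∈ (cvl (mcPoly d c)).toFinset →
      (∀ k, v k ∈ cvl (mcPoly d (a k))) ∧ Filter.Tendsto v l (nhds x) := by
    intro x
    by_cases hx : x ∈ (cvl (mcPoly d c)).toFinset
    · obtain ⟨v, h⟩ := exists_tendsto_of_mem_cvl hd ha (Multiset.mem_toFinset.1 hx)
      exact ⟨v, fun _ => h⟩
    · exact ⟨0, fun h => absurd h hx⟩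
  choose v hv using hv
  refine ⟨v, fun x hx => (hv x hx).2, ?_⟩
  have hinj : ∀ᶠ k in l, ∀ x ∈ (cvl (mcPoly d c)).toFinset,
      ∀ y ∈ (cvl (mcPoly d c)).toFinset, v x k = v y k → x = y := by
    rw [Filter.eventually_all_finset]
    intro x hx
    rw [Filter.eventually_all_finset]
    intro y hy
    by_cases hxy : x = y
    · exact Filter.Eventually.of_forall fun _ _ => hxy
    · filter_upwards [((hv x hx).2.sub (hv y hy).2).eventually_ne (sub_ne_zero.2 hxy)] with k hk h
      exact absurd (sub_eq_zero.2 h) hk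
  filter_upwards [hinj, hcard] with k hk hck y hy
  have himg : (cvl (mcPoly d c)).toFinset.image (fun x => v x k) =
      (cvl (mcPoly d (a k))).toFinset := by
    refine Finset.eq_of_subset_of_card_le ?_ ?_
    · intro y hy
      obtain ⟨x, hx, rfl⟩ := Finset.mem_image.1 hy
      exact Multiset.mem_toFinset.2 ((hv x hx).1 k)
    · rw [Finset.card_image_of_injOn fun x hx y hy h => hk x hx y hy h]
      exact hck
  rw [← Multiset.mem_toFinset, ← himg, Finset.mem_image] at hy
  exact hy

/-- A convergent family of monic centered polynomials, over the ring of convergent families. -/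
noncomputable def limMcPoly {ι : Type*} {l : Filter ι} {d : ℕ} {a : ι → Fin (d - 1) → ℂ}
    {c : Fin (d - 1) → ℂ} (ha : Filter.Tendsto a l (nhds c)) : (limAlgebra l)[X] :=
  X ^ d + ∑ i : Fin (d - 1), C (limMk (fun k => a k i) (c i) (tendsto_pi_nhds.1 ha i)) *
    X ^ (i : ℕ)

theorem map_limHom_limMcPoly {ι : Type*} {l : Filter ι} {d : ℕ} {a : ι → Fin (d - 1) → ℂ}
    {c : Fin (d - 1) → ℂ} (ha : Filter.Tendsto a l (nhds c)) :
    (limMcPoly ha).map (limHom l) = mcPoly d c := by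
  simp [limMcPoly, mcPoly, Polynomial.map_sum]

theorem map_termHom_limMcPoly {ι : Type*} {l : Filter ι} {d : ℕ} {a : ι → Fin (d - 1) → ℂ}
    {c : Fin (d - 1) → ℂ} (ha : Filter.Tendsto a l (nhds c)) (k : ι) :
    (limMcPoly ha).map (termHom l k) = mcPoly d (a k) := by
  simp [limMcPoly, mcPoly, Polynomial.map_sum]

/-- The monic multiple of the derivative of `limMcPoly`. -/
theorem monic_C_inv_mul_derivative_limMcPoly {ι : Type*} {l : Filter ι} {d : ℕ} (hd : 2 ≤ d)
    {a : ι → Fin (d - 1) → ℂ} {c : Fin (d - 1) → ℂ} (ha : Filter.Tendsto a l (nhds c)) :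
    (C (algebraMap ℂ (limAlgebra l) (d : ℂ)⁻¹) * (limMcPoly ha).derivative).Monic := by
  have hd0 : (d : ℂ) ≠ 0 := Nat.cast_ne_zero.2 (by omega)
  have hcoeff : ∀ k, d ≤ k →
      (limMcPoly ha).coeff k = if k = d then 1 else 0 := by
    intro k hk
    rw [limMcPoly, coeff_add, coeff_X_pow, finsetSum_coeff, Finset.sum_eq_zero, add_zero]
    intro i _
    have := i.2
    rw [coeff_C_mul_X_pow, if_neg (by omega)]
  refine monic_of_natDegree_le_of_coeff_eq_one (d - 1) ?_ ?_
  · rw [natDegree_le_iff_coeff_eq_zero]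
    intro k hk
    rw [coeff_C_mul, coeff_derivative, hcoeff _ (by omega), if_neg (by omega), zero_mul, mul_zero]
  · rw [coeff_C_mul, coeff_derivative, Nat.sub_add_cancel (by omega), hcoeff _ le_rfl, if_pos rfl,
      one_mul, ← Nat.cast_add_one, Nat.sub_add_cancel (by omega),
      ← map_natCast (algebraMap ℂ (limAlgebra l)), ← map_mul, inv_mul_cancel₀ hd0, map_one]

/-- First-order form of the comparison of two families of polynomials whose critical values are
roots of a common family `W`: with `f = g + ε δ`, the limit of `δ` satisfies a differential
divisibility relation. -/
theorem sq_derivative_dvd_of_limAlgebra {ι : Type*} {l : Filter ι} [l.NeBot] {d : ℕ} (hd : 2 ≤ d)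
    {a b : ι → Fin (d - 1) → ℂ} {c : Fin (d - 1) → ℂ} (ha : Filter.Tendsto a l (nhds c))
    (hb : Filter.Tendsto b l (nhds c)) {ε : limAlgebra l} {δ W : (limAlgebra l)[X]}
    (hε : limHom l ε = 0) (hε0 : ∀ᶠ k in l, termHom l k ε ≠ 0)
    (hδ : limMcPoly ha = limMcPoly hb + C ε * δ)
    (hWa : ∀ᶠ k in l, (mcPoly d (a k)).derivative ∣
      (W.map (termHom l k)).comp (mcPoly d (a k)))
    (hWb : ∀ᶠ k in l, (mcPoly d (b k)).derivative ∣
      (W.map (termHom l k)).comp (mcPoly d (b k))) :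
    (mcPoly d c).derivative * (mcPoly d c).derivative ∣
      δ.map (limHom l) * ((W.map (limHom l)).comp (mcPoly d c)).derivative -
        (δ.map (limHom l)).derivative * (W.map (limHom l)).comp (mcPoly d c) := by
  have hd0 : (d : ℂ) ≠ 0 := Nat.cast_ne_zero.2 (by omega)
  have hCd : (C (d : ℂ)⁻¹ * C (d : ℂ) : ℂ[X]) = 1 := by
    rw [← C_mul, inv_mul_cancel₀ hd0, C_1]
  set f := limMcPoly ha with hf
  set g := limMcPoly hb with hg
  set e : (limAlgebra l)[X] := C (algebraMap ℂ (limAlgebra l) (d : ℂ)⁻¹) with he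
  obtain ⟨S₀, hS₀⟩ := (W.map C).binomExpansion g (C ε * δ)
  have hS : W.comp f = W.comp g + C ε * δ * (W.derivative.comp g + S₀ * (C ε * δ)) := by
    rw [hδ, comp, comp, comp, ← eval_map, ← eval_map, ← eval_map, hS₀, derivative_map]
    ring
  set S := W.derivative.comp g + S₀ * (C ε * δ) with hSdef
  have hmf : (e * f.derivative).Monic := monic_C_inv_mul_derivative_limMcPoly hd ha
  have hmg : (e * g.derivative).Monic := monic_C_inv_mul_derivative_limMcPoly hd hb
  have key := map_limHom_dvd (p := δ * S * (e * g.derivative) - e * δ.derivative * W.comp g)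
    (hmf.mul hmg) (by
      filter_upwards [hε0, hWa, hWb] with k hk hka hkb
      obtain ⟨A, hA⟩ := hka
      obtain ⟨B, hB⟩ := hkb
      have hfk : f.map (termHom l k) = mcPoly d (a k) := map_termHom_limMcPoly ha k
      have hgk : g.map (termHom l k) = mcPoly d (b k) := map_termHom_limMcPoly hb k
      have h1 := congrArg (Polynomial.map (termHom l k)) hS
      have h2 := congrArg (fun q => (Polynomial.map (termHom l k) q).derivative) hδ
      simp only [Polynomial.map_add, Polynomial.map_mul, Polynomial.map_comp, map_C,
        hfk, hgk, hA, hB, derivative_add, derivative_mul, derivative_C, zero_mul, zero_add] at h1 h2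
      have hek : e.map (termHom l k) = C (d : ℂ)⁻¹ := by simp [he]
      simp only [Polynomial.map_sub, Polynomial.map_mul, Polynomial.map_comp, hek,
        ← derivative_map, hfk, hgk, hB]
      refine (IsUnit.dvd_mul_left (isUnit_C.2 (IsUnit.mk0 _ hk))).1 ?_
      refine ⟨C (d : ℂ) * (A - B), ?_⟩
      set D : ℂ[X] := C (d : ℂ)⁻¹
      set g' := (mcPoly d (b k)).derivative
      set f' := (mcPoly d (a k)).derivative
      linear_combination (-(D * g')) * h1 + D * g' * B * h2 - D * g' * f' * (A - B) * hCd)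
  have hfc : f.map (limHom l) = mcPoly d c := map_limHom_limMcPoly ha
  have hgc : g.map (limHom l) = mcPoly d c := map_limHom_limMcPoly hb
  have hec : e.map (limHom l) = C (d : ℂ)⁻¹ := by simp [he]
  simp only [hSdef, Polynomial.map_sub, Polynomial.map_mul, Polynomial.map_add,
    Polynomial.map_comp, ← derivative_map, map_C, hfc, hgc, hec, hε, C_0, zero_mul, mul_zero,
    add_zero] at key
  obtain ⟨Q, hQ⟩ := key
  refine ⟨C (d : ℂ)⁻¹ * Q, ?_⟩
  rw [derivative_comp]
  set D : ℂ[X] := C (d : ℂ)⁻¹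
  set P := mcPoly d c
  set W' := W.map (limHom l)
  set δ' := δ.map (limHom l)
  linear_combination C (d : ℂ) * hQ - (δ' * (derivative P * (derivative W').comp P) -
    derivative δ' * W'.comp P - derivative P * derivative P * (D * Q)) * hCd

/-- Two families of polynomials with the same limit and the same critical values agree, provided
that the number of critical values does not drop in the limit. -/
theorem eventually_eq_of_cvl_eq {ι : Type*} (l : Ultrafilter ι) {d : ℕ} (hd : 2 ≤ d)
    {a b : ι → Fin (d - 1) → ℂ} {c : Fin (d - 1) → ℂ} (ha : Filter.Tendsto a l (nhds c))
    (hb : Filter.Tendsto b l (nhds c))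
    (hab : ∀ᶠ k in (l : Filter ι), cvl (mcPoly d (a k)) = cvl (mcPoly d (b k)))
    (hcard : ∀ᶠ k in (l : Filter ι), (cvl (mcPoly d (a k))).toFinset.card ≤
      (cvl (mcPoly d c)).toFinset.card) :
    ∀ᶠ k in (l : Filter ι), a k = b k := by
  rw [← not_not (a := ∀ᶠ k in (l : Filter ι), a k = b k), ← Ultrafilter.eventually_not]
  intro hne
  have hP' : ∀ x : Fin (d - 1) → ℂ, (mcPoly d x).derivative ≠ 0 := fun x h => by
    have := natDegree_derivative_mcPoly x
    rw [h, natDegree_zero] at this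
    omega
  have hP := hP' c
  obtain ⟨v, hv, hvk⟩ := exists_tendsto_cvl hd ha hcard
  set W : (limAlgebra (l : Filter ι))[X] :=
    ∏ x ∈ (cvl (mcPoly d c)).toFinset.attach, (X - C (limMk (v x) x (hv x x.2))) with hW
  have hWk : ∀ k, W.map (termHom (l : Filter ι) k) = ∏ x ∈ (cvl (mcPoly d c)).toFinset, (X - C (v x k)) := by
    intro k
    rw [hW, Polynomial.map_prod, ← Finset.prod_attach (cvl (mcPoly d c)).toFinset]
    simp
  have hWc : W.map (limHom (l : Filter ι)) = ∏ x ∈ (cvl (mcPoly d c)).toFinset, (X - C x) := by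
    rw [hW, Polynomial.map_prod, ← Finset.prod_attach (cvl (mcPoly d c)).toFinset]
    simp
  have hWroot : ∀ᶠ k in (l : Filter ι), ∀ y ∈ cvl (mcPoly d (a k)),
      (W.map (termHom (l : Filter ι) k)).IsRoot y := by
    filter_upwards [hvk] with k hk y hy
    obtain ⟨x, hx, rfl⟩ := hk y hy
    rw [hWk, IsRoot, eval_prod]
    exact Finset.prod_eq_zero hx (by simp)
  have hWa : ∀ᶠ k in (l : Filter ι), (mcPoly d (a k)).derivative ∣
      (W.map (termHom (l : Filter ι) k)).comp (mcPoly d (a k)) := by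
    filter_upwards [hWroot] with k hk
    exact derivative_dvd_comp (hP' _) fun z hz =>
      hk _ (Multiset.mem_map_of_mem _ ((mem_roots (hP' _)).2 hz))
  have hWb : ∀ᶠ k in (l : Filter ι), (mcPoly d (b k)).derivative ∣
      (W.map (termHom (l : Filter ι) k)).comp (mcPoly d (b k)) := by
    filter_upwards [hWroot, hab] with k hk habk
    rw [habk] at hk
    exact derivative_dvd_comp (hP' _) fun z hz =>
      hk _ (Multiset.mem_map_of_mem _ ((mem_roots (hP' _)).2 hz))
  set u : ι → Fin (d - 1) → ℂ := fun k => (‖a k - b k‖⁻¹ : ℂ) • (a k - b k) with hu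
  have hu1 : ∀ k, a k ≠ b k → ‖u k‖ = 1 := fun k hk => by
    have : ‖a k - b k‖ ≠ 0 := norm_ne_zero_iff.2 (sub_ne_zero.2 hk)
    rw [hu, norm_smul, norm_inv, Complex.norm_real, norm_norm, inv_mul_cancel₀ this]
  have huk : ∀ k, a k - b k = (‖a k - b k‖ : ℂ) • u k := fun k => by
    by_cases hk : a k = b k
    · simp [hk]
    · have : (‖a k - b k‖ : ℂ) ≠ 0 :=
        Complex.ofReal_ne_zero.2 (norm_ne_zero_iff.2 (sub_ne_zero.2 hk))
      rw [hu, smul_smul, mul_inv_cancel₀ this, one_smul]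
  obtain ⟨w, hw1, hw⟩ : ∃ w : Fin (d - 1) → ℂ, ‖w‖ = 1 ∧ Filter.Tendsto u l (nhds w) := by
    obtain ⟨w, hw, hw'⟩ := (isCompact_sphere (0 : Fin (d - 1) → ℂ) 1).ultrafilter_le_nhds
      (l.map u) (by
        rw [Filter.le_principal_iff, Ultrafilter.mem_coe, Ultrafilter.mem_map]
        filter_upwards [hne] with k hk
        simpa using hu1 k hk)
    exact ⟨w, by simpa using hw, hw'⟩
  have hε : Filter.Tendsto (fun k => (‖a k - b k‖ : ℂ)) l (nhds 0) := by
    have h := (ha.sub hb).norm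
    rw [sub_self, norm_zero] at h
    exact_mod_cast (Complex.continuous_ofReal.tendsto 0).comp h
  set δ : (limAlgebra (l : Filter ι))[X] :=
    ∑ i : Fin (d - 1), C (limMk (fun k => u k i) (w i) (tendsto_pi_nhds.1 hw i)) * X ^ (i : ℕ)
    with hδ
  have hfg : limMcPoly ha = limMcPoly hb + C (limMk _ 0 hε) * δ := by
    rw [limMcPoly, limMcPoly, hδ, add_assoc, Finset.mul_sum, ← Finset.sum_add_distrib]
    congr 1
    refine Finset.sum_congr rfl fun i _ => ?_
    rw [← mul_assoc, ← C_mul, ← add_mul, ← C_add]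
    congr 2
    refine Subtype.ext (Prod.ext (funext fun k => ?_) ?_)
    · have := congrFun (huk k) i
      simp only [Pi.sub_apply, Pi.smul_apply, smul_eq_mul] at this
      exact sub_eq_iff_eq_add'.1 this
    · change c i = c i + 0 * w i
      ring
  have hδc : δ.map (limHom (l : Filter ι)) = ∑ i : Fin (d - 1), C (w i) * X ^ (i : ℕ) := by
    rw [hδ, Polynomial.map_sum]
    simp
  have h1 := sq_derivative_dvd_of_limAlgebra hd ha hb (ε := limMk _ 0 hε) (limHom_limMk hε)
    (by
      filter_upwards [hne] with k hk
      rw [termHom_limMk]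
      exact Complex.ofReal_ne_zero.2 (norm_ne_zero_iff.2 (sub_ne_zero.2 hk))) hfg hWa hWb
  have h2 : (mcPoly d c).derivative ∣ δ.map (limHom (l : Filter ι)) := by
    refine derivative_dvd_of_sq_dvd hP (fun z hz => ?_) h1
    have hmem : (mcPoly d c).eval z ∈ (cvl (mcPoly d c)).toFinset :=
      Multiset.mem_toFinset.2 (Multiset.mem_map_of_mem _ ((mem_roots hP).2 hz))
    rw [hWc]
    constructor
    · rw [IsRoot, eval_prod]
      exact Finset.prod_eq_zero hmem (by simp)
    · have h := Lagrange.eval_nodal_derivative_eval_node_eq (v := id) hmem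
      rw [Lagrange.nodal, id] at h
      rw [show ∏ x ∈ (cvl (mcPoly d c)).toFinset, (X - C x) =
        ∏ x ∈ (cvl (mcPoly d c)).toFinset, (X - C (id x)) from rfl, h]
      exact Lagrange.eval_nodal_not_at_node fun x hx => (Finset.ne_of_mem_erase hx).symm
  have h3 : δ.map (limHom (l : Filter ι)) = 0 := by
    refine eq_zero_of_dvd_of_natDegree_lt h2 ?_
    rw [natDegree_derivative_mcPoly, hδc]
    refine lt_of_le_of_lt (natDegree_sum_le_of_forall_le _ _ (n := d - 2) fun i _ => ?_) (by omega)
    exact (natDegree_C_mul_X_pow_le _ _).trans (by have := i.2; omega)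
  have h4 : w = 0 := by
    ext i
    have h := congrArg (fun q : ℂ[X] => q.coeff i) h3
    simp only [hδc, finsetSum_coeff, coeff_C_mul_X_pow, coeff_zero] at h
    rwa [Finset.sum_eq_single i (fun j _ hj => if_neg fun h' => hj (Fin.ext h'.symm)) (by simp),
      if_pos rfl] at h
  rw [h4, norm_zero] at hw1
  exact zero_ne_one hw1

theorem IsMergeOf.card_le {μ lam : Multiset ℕ} (h : IsMergeOf μ lam) : μ.card ≤ lam.card := by
  obtain ⟨m, hm, rfl, rfl⟩ := h
  rw [Multiset.card_map, Multiset.card_join]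
  calc m.card = (m.map fun _ => 1).sum := by simp
    _ ≤ (m.map Multiset.card).sum := Multiset.sum_map_le_sum_map _ _ fun s hs =>
      Multiset.card_pos.2 (hm s hs)

theorem card_mshape {X : Type*} [DecidableEq X] (M : Multiset X) :
    (mshape M).card = M.toFinset.card := by
  rw [mshape, Multiset.card_map, Finset.card_val]
  convert rfl

/-- Lifts of a critical value path with weakly decreasing shape are determined by their end. -/
theorem eq_of_cvl_eq_of_end_eq {d : ℕ} (hd : 2 ≤ d)
    {a b : Set.Icc (0 : ℝ) 1 → (Fin (d - 1) → ℂ)} (ha : Continuous a) (hb : Continuous b)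
    (hdec : ∀ s t : Set.Icc (0 : ℝ) 1, s ≤ t →
      IsMergeOf (mshape (cvl (mcPoly d (a s)))) (mshape (cvl (mcPoly d (a t)))))
    (hab : ∀ t, cvl (mcPoly d (a t)) = cvl (mcPoly d (b t))) (hend : a ⊤ = b ⊤) : a = b := by
  by_contra hne
  set S : Set (Set.Icc (0 : ℝ) 1) := {t | a t ≠ b t}
  have hS : IsOpen S := isOpen_ne_fun ha hb
  have hSne : S.Nonempty := Function.ne_iff.1 hne
  obtain ⟨τ, hτ, hτmax⟩ := isClosed_closure.isCompact.exists_isGreatest hSne.closure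
  have hle : ∀ s ∈ S, s ≤ τ := fun s hs => hτmax (subset_closure hs)
  have hτeq : a τ = b τ := by
    by_contra hτS
    have hτtop : τ < ⊤ := lt_top_iff_ne_top.2 fun h => hτS (by rw [h, hend])
    have hcl : τ ∈ closure (Set.Ioi τ) := by
      rw [closure_Ioi' ⟨⊤, hτtop⟩]
      exact Set.mem_Ici.2 le_rfl
    obtain ⟨s, hs, hs'⟩ := mem_closure_iff.1 hcl S hS hτS
    exact absurd (hle s hs) (not_le.2 hs')
  obtain ⟨l, hlS, hl⟩ := mem_closure_iff_ultrafilter.1 hτ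
  have h := eventually_eq_of_cvl_eq l hd (ha.continuousAt.mono_left hl)
    (hτeq ▸ hb.continuousAt.mono_left hl) (Filter.Eventually.of_forall hab) (by
      filter_upwards [hlS] with s hs
      rw [← card_mshape, ← card_mshape]
      exact (hdec s τ (hle s hs)).card_le)
  obtain ⟨s, heq, hmem⟩ := (h.and (show ∀ᶠ s in (l : Filter _), s ∈ S from hlS)).exists
  exact hmem heq

/-- A multiset path of critical values with weakly decreasing shape has at most
`d^(d-2)` lifts through the Lyashko–Looijenga map with a given polynomial start point. -/
theorem stmt_12 (d : ℕ) (hd : 2 ≤ d)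
    (a₀ : Set.Icc (0:ℝ) 1 → (Fin (d - 1) → ℂ)) (h₀ : Continuous a₀)
    (hdec : ∀ s t : Set.Icc (0:ℝ) 1, s ≤ t →
      IsMergeOf (mshape (cvl (mcPoly d (a₀ s)))) (mshape (cvl (mcPoly d (a₀ t)))))
    (x₀ : Fin (d - 1) → ℂ)
    (hx₀ : cvl (mcPoly d x₀) = cvl (mcPoly d (a₀ ⟨0, by norm_num⟩))) :
    {a : Set.Icc (0:ℝ) 1 → (Fin (d - 1) → ℂ) | Continuous a ∧
        a ⟨0, by norm_num⟩ = x₀ ∧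
        ∀ t, cvl (mcPoly d (a t)) = cvl (mcPoly d (a₀ t))}.Finite ∧
      {a : Set.Icc (0:ℝ) 1 → (Fin (d - 1) → ℂ) | Continuous a ∧
        a ⟨0, by norm_num⟩ = x₀ ∧
        ∀ t, cvl (mcPoly d (a t)) = cvl (mcPoly d (a₀ t))}.ncard ≤ d ^ (d - 2) := by
  have htop : ∀ B : Set (Fin (d - 1) → ℂ), (∀ x ∈ B, cvl (mcPoly d x) = cvl (mcPoly d (a₀ ⊤))) →
      B.Finite ∧ B.ncard ≤ d ^ (d - 2) := by
    intro B hB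
    have hfin : B.Finite := by
      by_contra hinf
      obtain ⟨s, hs, hcard⟩ := Set.Infinite.exists_subset_card_eq hinf (d ^ (d - 2) + 1)
      have := card_fibre_le hd _ s fun x hx => hB x (hs hx)
      omega
    refine ⟨hfin, ?_⟩
    rw [Set.ncard_eq_toFinset_card B hfin]
    exact card_fibre_le hd _ _ fun x hx => hB x (hfin.mem_toFinset.1 hx)
  set A : Set (Set.Icc (0:ℝ) 1 → (Fin (d - 1) → ℂ)) := {a | Continuous a ∧
    a ⟨0, by norm_num⟩ = x₀ ∧ ∀ t, cvl (mcPoly d (a t)) = cvl (mcPoly d (a₀ t))}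
  have hinj : Set.InjOn (fun a : Set.Icc (0:ℝ) 1 → (Fin (d - 1) → ℂ) => a ⊤) A := by
    rintro a ⟨ha, -, ha'⟩ b ⟨hb, -, hb'⟩ hab
    refine eq_of_cvl_eq_of_end_eq hd ha hb (fun s t hst => ?_) (fun t => by rw [ha', hb']) hab
    rw [ha', ha']
    exact hdec s t hst
  obtain ⟨h1, h2⟩ := htop ((fun a => a ⊤) '' A) (by
    rintro _ ⟨a, ⟨-, -, ha⟩, rfl⟩
    exact ha ⊤)
  exact ⟨(Set.finite_image_iff hinj).1 h1, by rwa [hinj.ncard_image] at h2⟩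
end

section
/- Let d ≥ 2. In the space Fin (d−1) → ℂ of coefficient vectors of monic centered degree-d polynomials, the closure of the set {a | ∀ z : ℂ, (p_a).derivative.IsRoot z → ‖(p_a).eval z‖ < 1} (polynomials whose critical values all lie in the open unit disk) equals the set {a | ∀ z : ℂ, (p_a).derivative.IsRoot z → ‖(p_a).eval z‖ ≤ 1} (polynomials whose critical values all lie in the closed unit disk). In particular the latter is a compactification of the former. -/
open Polynomial

open Filter Topology

/-- A complex polynomial that is small at `z` has a root near `z`. -/
theorem Polynomial.exists_isRoot_norm_sub_lt {P : ℂ[X]} {z : ℂ} {ε : ℝ} (hε : 0 ≤ ε)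
    (h : ‖P.eval z‖ < ‖P.leadingCoeff‖ * ε ^ P.natDegree) :
    ∃ c, P.IsRoot c ∧ ‖z - c‖ < ε := by
  by_contra! hc
  have hP := IsAlgClosed.splits P
  have hle : ε ^ P.natDegree ≤ (P.roots.map fun c => ‖z - c‖).prod := by
    have key : ∀ s : Multiset ℂ, (∀ c ∈ s, ε ≤ ‖z - c‖) →
        ε ^ s.card ≤ (s.map fun c => ‖z - c‖).prod := by
      intro s
      induction s using Multiset.induction_on with
      | empty => simp
      | cons c s ih =>
        intro hs
        rw [Multiset.card_cons, Multiset.map_cons, Multiset.prod_cons, pow_succ']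
        exact mul_le_mul (hs c (by simp)) (ih fun x hx => hs x (by simp [hx]))
          (pow_nonneg hε _) (norm_nonneg _)
    rw [hP.natDegree_eq_card_roots]
    exact key _ fun c hcs => hc c (isRoot_of_mem_roots hcs)
  have heval : ‖P.eval z‖ = ‖P.leadingCoeff‖ * (P.roots.map fun c => ‖z - c‖).prod := by
    have hnorm : ‖(P.roots.map fun c => z - c).prod‖ =
        (P.roots.map fun c => ‖z - c‖).prod := by
      simpa [Multiset.map_map, Function.comp_def] using
        map_multiset_prod (normHom : ℂ →*₀ ℝ) (P.roots.map fun c => z - c)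
    rw [hP.eval_eq_prod_roots, norm_mul, hnorm]
  rw [heval] at h
  exact absurd h (not_lt.mpr (mul_le_mul_of_nonneg_left hle (norm_nonneg _)))

theorem mcPoly_eval (d : ℕ) (a : Fin (d - 1) → ℂ) (z : ℂ) :
    (mcPoly d a).eval z = z ^ d + ∑ i, a i * z ^ (i : ℕ) := by
  simp [mcPoly, eval_finsetSum]

theorem mcPoly_derivative_eval (d : ℕ) (a : Fin (d - 1) → ℂ) (z : ℂ) :
    (mcPoly d a).derivative.eval z =
      d * z ^ (d - 1) + ∑ i, a i * ((i : ℕ) * z ^ ((i : ℕ) - 1)) := by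
  simp [mcPoly, eval_finsetSum, derivative_X_pow]

theorem degree_mcPoly_tail_lt (d : ℕ) (a : Fin (d - 1) → ℂ) :
    (∑ i : Fin (d - 1), C (a i) * X ^ (i : ℕ)).degree < (d : WithBot ℕ) := by
  refine (degree_sum_le _ _).trans_lt ((Finset.sup_lt_iff (WithBot.bot_lt_coe d)).mpr ?_)
  intro i _
  refine (degree_C_mul_X_pow_le _ _).trans_lt ?_
  exact WithBot.coe_lt_coe.mpr (by simp; omega)

theorem mcPoly_monic (d : ℕ) (a : Fin (d - 1) → ℂ) : (mcPoly d a).Monic :=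
  monic_X_pow_add (degree_mcPoly_tail_lt d a)

theorem mcPoly_natDegree (d : ℕ) (a : Fin (d - 1) → ℂ) : (mcPoly d a).natDegree = d := by
  rw [mcPoly, natDegree_eq_of_degree_eq_some]
  rw [degree_add_eq_left_of_degree_lt] <;> rw [degree_X_pow]
  exact degree_mcPoly_tail_lt d a

theorem mcPoly_derivative_natDegree (d : ℕ) (a : Fin (d - 1) → ℂ) :
    (mcPoly d a).derivative.natDegree = d - 1 := by
  rw [natDegree_derivative, mcPoly_natDegree]

theorem mcPoly_derivative_leadingCoeff {d : ℕ} (hd : 0 < d) (a : Fin (d - 1) → ℂ) :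
    (mcPoly d a).derivative.leadingCoeff = d := by
  have hlead : (mcPoly d a).coeff d = 1 := by
    simpa [mcPoly_natDegree] using (mcPoly_monic d a).coeff_natDegree
  rw [leadingCoeff, mcPoly_derivative_natDegree, coeff_derivative, Nat.sub_add_cancel hd, hlead]
  push_cast [Nat.cast_sub (show 1 ≤ d from hd)]
  ring

/-- The polynomials whose critical values all lie in the closed unit disk form a closed set. -/
theorem isClosed_mcPoly_criticalValues_le {d : ℕ} (hd : 0 < d) :
    IsClosed {a : Fin (d - 1) → ℂ |
      ∀ z : ℂ, (mcPoly d a).derivative.IsRoot z → ‖(mcPoly d a).eval z‖ ≤ 1} := by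
  refine isClosed_of_closure_subset fun a ha z hz => ?_
  by_contra! hlt
  have hcont : Continuous fun q : (Fin (d - 1) → ℂ) × ℂ => ‖(mcPoly d q.1).eval q.2‖ := by
    simp only [mcPoly_eval]
    fun_prop
  have hnear : ∀ᶠ q in 𝓝 a ×ˢ 𝓝 z, 1 < ‖(mcPoly d q.1).eval q.2‖ := by
    rw [← nhds_prod_eq]
    exact hcont.continuousAt.eventually_const_lt hlt
  obtain ⟨p, hp, q, hq, hpq⟩ := eventually_prod_iff.mp hnear
  obtain ⟨ε, hε, hball⟩ := Metric.eventually_nhds_iff.mp hq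
  have hcont' : Continuous fun b : Fin (d - 1) → ℂ => ‖(mcPoly d b).derivative.eval z‖ := by
    simp only [mcPoly_derivative_eval]
    fun_prop
  have hsmall : ∀ᶠ b in 𝓝 a, ‖(mcPoly d b).derivative.eval z‖ < d * ε ^ (d - 1) := by
    refine hcont'.continuousAt.eventually_lt_const ?_
    simp only [hz.eq_zero, norm_zero]
    positivity
  obtain ⟨b, hb, hpb, hsb⟩ :=
    ((mem_closure_iff_frequently.mp ha).and_eventually (hp.and hsmall)).exists
  obtain ⟨c, hc, hzc⟩ := exists_isRoot_norm_sub_lt (P := (mcPoly d b).derivative) (z := z) hε.le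
    (by simpa only [mcPoly_derivative_leadingCoeff hd, mcPoly_derivative_natDegree,
      Complex.norm_natCast] using hsb)
  exact absurd (hb c hc) (not_le.mpr (hpq hpb (hball (by rwa [dist_comm, dist_eq_norm]))))

/-- The rescaling `z ↦ t ^ d * p (z / t)` of monic centered polynomials, on coefficients. -/
def mcScale (d : ℕ) (t : ℂ) (a : Fin (d - 1) → ℂ) : Fin (d - 1) → ℂ :=
  fun i => a i * t ^ (d - (i : ℕ))

theorem mcPoly_mcScale_eval (d : ℕ) (t : ℂ) (a : Fin (d - 1) → ℂ) (z : ℂ) :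
    (mcPoly d (mcScale d t a)).eval (t * z) = t ^ d * (mcPoly d a).eval z := by
  simp only [mcPoly_eval, mcScale, mul_add, Finset.mul_sum, mul_pow]
  congr 1
  refine Finset.sum_congr rfl fun i _ => ?_
  rw [← pow_sub_mul_pow t (show (i : ℕ) ≤ d by omega)]
  ring

theorem mcPoly_mcScale_derivative_eval (d : ℕ) (t : ℂ) (a : Fin (d - 1) → ℂ) (z : ℂ) :
    (mcPoly d (mcScale d t a)).derivative.eval (t * z) =
      t ^ (d - 1) * (mcPoly d a).derivative.eval z := by
  simp only [mcPoly_derivative_eval, mcScale, mul_add, Finset.mul_sum, mul_pow]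
  congr 1
  · ring
  refine Finset.sum_congr rfl fun i _ => ?_
  rcases Nat.eq_zero_or_pos (i : ℕ) with hi | hi
  · simp [hi]
  rw [← pow_sub_mul_pow t (show (i : ℕ) - 1 ≤ d - 1 by omega),
    show d - 1 - ((i : ℕ) - 1) = d - i by omega]
  ring

/-- The closure of the set of monic centered degree-`d` polynomials with all critical
values in the open unit disk is the set of those with all critical values in the closed
unit disk. -/
theorem stmt_15 (d : ℕ) (hd : 2 ≤ d) :
    closure {a : Fin (d - 1) → ℂ |
        ∀ z : ℂ, (mcPoly d a).derivative.IsRoot z → ‖(mcPoly d a).eval z‖ < 1} =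
      {a : Fin (d - 1) → ℂ |
        ∀ z : ℂ, (mcPoly d a).derivative.IsRoot z → ‖(mcPoly d a).eval z‖ ≤ 1} := by
  refine Set.Subset.antisymm
    (closure_minimal (fun a ha z hz => (ha z hz).le)
      (isClosed_mcPoly_criticalValues_le (by omega))) fun a ha => ?_
  have hlim : Tendsto (fun t : ℝ => mcScale d t a) (𝓝[<] 1) (𝓝 a) := by
    have hcont : Continuous fun t : ℝ => mcScale d t a := by
      unfold mcScale
      fun_prop
    have hone : mcScale d ((1 : ℝ) : ℂ) a = a := by
      ext i
      simp [mcScale]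
    simpa only [hone] using (hcont.tendsto 1).mono_left nhdsWithin_le_nhds
  refine mem_closure_of_tendsto hlim ?_
  filter_upwards [Ioo_mem_nhdsLT (zero_lt_one' ℝ)] with t ⟨ht0, ht1⟩ w hw
  have ht : (t : ℂ) ≠ 0 := by exact_mod_cast ht0.ne'
  obtain ⟨z, rfl⟩ : ∃ z, w = t * z := ⟨w / t, by field_simp⟩
  rw [IsRoot, mcPoly_mcScale_derivative_eval, mul_eq_zero] at hw
  have hz := ha z (hw.resolve_left (pow_ne_zero _ ht))
  rw [mcPoly_mcScale_eval, norm_mul, norm_pow, Complex.norm_of_nonneg ht0.le]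
  calc t ^ d * ‖(mcPoly d a).eval z‖ ≤ t ^ d := mul_le_of_le_one_right (by positivity) hz
    _ < 1 := pow_lt_one₀ ht0.le ht1 (by omega)
end
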